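/- arXiv:1712.06952 — 5 statements merged into one kernel-verified Lean document; each statement's English description precedes it below -/
import Mathlib

section
/- If a linear pentapod design is not architecturally singular, then there exist pairwise distinct indices i,j,k ∈ {1,…,5} such that the base points M_i, M_j, M_k are not collinear (they form a triangle) and r_i ≠ r_j (so the corresponding platform anchor points m_i = p + r_i·(u,v,w) and m_j = p + r_j·(u,v,w) are distinct in every pose with u²+v²+w²=1). -/
open Matrix

/-- The 7×7 matrix `S` of a linear pentapod design with platform parameters
`r` and base coordinates `x`, `y`, `z` (indices `1,…,4` of `Fin 5` correspond to
legs `2,…,5`; index `0` corresponds to leg `1`), at pose `(u,v,w,px,py,pz)`. -/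
noncomputable def Smat (r x y z : Fin 5 → ℝ) (u v w px py pz : ℝ) :
    Matrix (Fin 7) (Fin 7) ℝ :=
  !![(1 : ℝ), u, v, w, px, py, pz;
     0, px, py, pz, 0, 0, 0;
     0, 0, 0, 0, u, v, w;
     r 1, x 1, y 1, z 1, r 1 * x 1, r 1 * y 1, r 1 * z 1;
     r 2, x 2, y 2, z 2, r 2 * x 2, r 2 * y 2, r 2 * z 2;
     r 3, x 3, y 3, z 3, r 3 * x 3, r 3 * y 3, r 3 * z 3;
     r 4, x 4, y 4, z 4, r 4 * x 4, r 4 * y 4, r 4 * z 4]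

/-- The 4×7 architecture matrix of the design. -/
noncomputable def archMat (r x y z : Fin 5 → ℝ) : Matrix (Fin 4) (Fin 7) ℝ :=
  !![r 1, x 1, y 1, z 1, r 1 * x 1, r 1 * y 1, r 1 * z 1;
     r 2, x 2, y 2, z 2, r 2 * x 2, r 2 * y 2, r 2 * z 2;
     r 3, x 3, y 3, z 3, r 3 * x 3, r 3 * y 3, r 3 * z 3;
     r 4, x 4, y 4, z 4, r 4 * x 4, r 4 * y 4, r 4 * z 4]

/-- The design is architecturally singular: the singularity polynomial `det S`
vanishes at every pose on the quadric `u² + v² + w² = 1`. -/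
def ArchSingular (r x y z : Fin 5 → ℝ) : Prop :=
  ∀ u v w px py pz : ℝ, u ^ 2 + v ^ 2 + w ^ 2 = 1 →
    (Smat r x y z u v w px py pz).det = 0

/-- The bracket `[A₁, A₂, A₃, A₄]`: the determinant of the 4×4 matrix with
columns `A₁, A₂, A₃, A₄`. -/
noncomputable def bracket (A1 A2 A3 A4 : Fin 4 → ℝ) : ℝ :=
  (Matrix.of fun i j => ![A1, A2, A3, A4] j i).det

/-- The vector in `ℝ⁴` formed by the values of `f` at legs `2,…,5`. -/
def colVec (f : Fin 5 → ℝ) : Fin 4 → ℝ := fun i => f i.succ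

/-- The componentwise product vector (e.g. `rX`, `rY`, `rZ`) for legs `2,…,5`. -/
def colProd (r f : Fin 5 → ℝ) : Fin 4 → ℝ := fun i => r i.succ * f i.succ

/-- The base anchor point `M_j = (x_j, y_j, z_j) ∈ ℝ³`. -/
def Mpt (x y z : Fin 5 → ℝ) (j : Fin 5) : Fin 3 → ℝ := ![x j, y j, z j]

/-- If three points are not collinear, then any fourth point spans a triangle with two of them. -/
lemma not_collinear_triple_of_not_collinear {V : Type*} [AddCommGroup V] [Module ℝ V]
    {a b c : V} (h : ¬ Collinear ℝ ({a, b, c} : Set V)) (l : V) :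
    ¬ Collinear ℝ ({l, a, b} : Set V) ∨ ¬ Collinear ℝ ({l, a, c} : Set V) ∨
      ¬ Collinear ℝ ({l, b, c} : Set V) := by
  by_contra! hcon
  obtain ⟨hab, hac, hbc⟩ := hcon
  by_cases hla : l = a
  · exact h (hla ▸ hbc)
  · have hb : b ∈ line[ℝ, l, a] :=
      hab.mem_affineSpan_of_mem_of_ne (by simp) (by simp) (by simp) hla
    have hc : c ∈ line[ℝ, l, a] :=
      hac.mem_affineSpan_of_mem_of_ne (by simp) (by simp) (by simp) hla
    have hcol := collinear_triple_of_mem_affineSpan_pair (right_mem_affineSpan_pair ℝ l a) hb hc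
    exact h hcol

/-- If `r` is constant on every triangle formed by three of the points `M`, then either `r` is
constant or all triples of points are collinear. -/
lemma forall_eq_or_forall_collinear {ι V : Type*} [AddCommGroup V] [Module ℝ V]
    (M : ι → V) (r : ι → ℝ)
    (h : ∀ i j k : ι, i ≠ j → i ≠ k → j ≠ k →
      ¬ Collinear ℝ ({M i, M j, M k} : Set V) → r i = r j) :
    (∀ i j, r i = r j) ∨ ∀ i j k, Collinear ℝ ({M i, M j, M k} : Set V) := by
  have key : ∀ i j k, ¬ Collinear ℝ ({M i, M j, M k} : Set V) → r i = r j := by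
    intro i j k hijk
    refine h i j k ?_ ?_ ?_ hijk <;> rintro rfl <;> apply hijk
    · simpa using collinear_pair ℝ _ _
    · rw [Set.insert_comm]; simpa using collinear_pair ℝ _ _
    · simpa using collinear_pair ℝ _ _
  by_contra! hcon
  obtain ⟨⟨p, q, hpq⟩, a, b, c, habc⟩ := hcon
  have hbc : ¬ Collinear ℝ ({M b, M a, M c} : Set V) := by rwa [Set.insert_comm]
  have hr : ∀ l, r l = r a := by
    intro l
    rcases not_collinear_triple_of_not_collinear habc (M l) with hl | hl | hl
    · exact key _ _ _ hl
    · exact key _ _ _ hl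
    · exact (key _ _ _ hl).trans (key _ _ _ hbc)
  exact hpq ((hr p).trans (hr q).symm)

/-- If the architecture matrix factors through a three-dimensional space, the design is
architecturally singular. -/
lemma archSingular_of_archMat_eq_mul {r x y z : Fin 5 → ℝ} (A : Matrix (Fin 4) (Fin 3) ℝ)
    (B : Matrix (Fin 3) (Fin 7) ℝ) (h : archMat r x y z = A * B) : ArchSingular r x y z := by
  intro u v w px py pz _
  obtain ⟨c, hc, hc0⟩ : ∃ c ∈ LinearMap.ker A.vecMulLinear, c ≠ 0 :=
    Submodule.exists_mem_ne_zero_of_ne_bot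
      (LinearMap.ker_ne_bot_of_finrank_lt (by simp))
  have hcM : c ᵥ* archMat r x y z = 0 := by
    have hcA : c ᵥ* A = 0 := by simpa using hc
    rw [h, ← Matrix.vecMul_vecMul, hcA, Matrix.zero_vecMul]
  refine Matrix.exists_vecMul_eq_zero_iff.mp ⟨![0, 0, 0, c 0, c 1, c 2, c 3], ?_, ?_⟩
  · intro h0
    apply hc0
    funext i
    fin_cases i
    · simpa using congrFun h0 3
    · simpa using congrFun h0 4
    · simpa using congrFun h0 5
    · simpa using congrFun h0 6
  · funext j
    have hj := congrFun hcM j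
    fin_cases j <;>
      simpa [Matrix.vecMul, dotProduct, Fin.sum_univ_succ, Smat, archMat] using hj

/-- If all `r j` vanish, the design is architecturally singular. -/
lemma archSingular_of_platform_eq_zero {r : Fin 5 → ℝ} (x y z : Fin 5 → ℝ) (hr : ∀ j, r j = 0) :
    ArchSingular r x y z := by
  refine archSingular_of_archMat_eq_mul
    (Matrix.of fun i => ![x i.succ, y i.succ, z i.succ])
    !![0, 1, 0, 0, 0, 0, 0; 0, 0, 1, 0, 0, 0, 0; 0, 0, 0, 1, 0, 0, 0] ?_
  ext i j
  fin_cases i <;> fin_cases j <;>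
    simp [archMat, hr, Matrix.mul_apply, Fin.sum_univ_succ]

/-- If all base points lie on a line through the origin, the design is architecturally singular. -/
lemma archSingular_of_base_eq_smul (r : Fin 5 → ℝ) {x y z : Fin 5 → ℝ} (t : Fin 5 → ℝ)
    (d : Fin 3 → ℝ) (h : ∀ j, Mpt x y z j = t j • d) : ArchSingular r x y z := by
  have hx : ∀ j, x j = t j * d 0 := fun j => by simpa [Mpt] using congrFun (h j) 0
  have hy : ∀ j, y j = t j * d 1 := fun j => by simpa [Mpt] using congrFun (h j) 1
  have hz : ∀ j, z j = t j * d 2 := fun j => by simpa [Mpt] using congrFun (h j) 2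
  refine archSingular_of_archMat_eq_mul
    (Matrix.of fun i => ![r i.succ, t i.succ, r i.succ * t i.succ])
    !![1, 0, 0, 0, 0, 0, 0; 0, d 0, d 1, d 2, 0, 0, 0; 0, 0, 0, 0, d 0, d 1, d 2] ?_
  ext i j
  fin_cases i <;> fin_cases j <;>
    simp [archMat, hx, hy, hz, Matrix.mul_apply, Fin.sum_univ_succ, mul_assoc]

theorem stmt1 (r x y z : Fin 5 → ℝ)
    (hr1 : r 0 = 0) (hx1 : x 0 = 0) (hy1 : y 0 = 0) (hz1 : z 0 = 0)
    (hns : ¬ ArchSingular r x y z) :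
    ∃ i j k : Fin 5, i ≠ j ∧ i ≠ k ∧ j ≠ k ∧
      ¬ Collinear ℝ ({Mpt x y z i, Mpt x y z j, Mpt x y z k} : Set (Fin 3 → ℝ)) ∧
      r i ≠ r j := by
  by_contra! hcon
  apply hns
  have h0 : Mpt x y z 0 = 0 := by
    funext i
    fin_cases i <;> simp [Mpt, hx1, hy1, hz1]
  rcases forall_eq_or_forall_collinear (Mpt x y z) r hcon with hr | hcol
  · exact archSingular_of_platform_eq_zero x y z fun j => (hr j 0).trans hr1
  · by_cases hM : ∃ k, Mpt x y z k ≠ 0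
    · obtain ⟨k, hk⟩ := hM
      have hline : ∀ j, ∃ t : ℝ, Mpt x y z j = t • Mpt x y z k := by
        intro j
        have hj : Mpt x y z j ∈ line[ℝ, Mpt x y z 0, Mpt x y z k] :=
          (hcol 0 k j).mem_affineSpan_of_mem_of_ne (by simp) (by simp) (by simp)
            (by rw [h0]; exact hk.symm)
        obtain ⟨t, ht⟩ := mem_affineSpan_pair_iff_exists_lineMap_eq.mp hj
        exact ⟨t, by rw [← ht, h0, AffineMap.lineMap_apply]; simp⟩
      choose t ht using hline
      exact archSingular_of_base_eq_smul r t _ ht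
    · push Not at hM
      exact archSingular_of_base_eq_smul r 0 0 (by simpa using hM)
end

section
/- Let a linear pentapod design have a planar base and not be architecturally singular. Then det S is linear in the position variables if and only if there exist α, β ∈ ℝ such that r_j = α x_j + β y_j for all j = 1,…,5 (i.e., there is a singular affine mapping κ from the base plane to the platform line sending M_j to m_j). -/
open Matrix

/-- The expansion of a `4 × 4` bracket in coordinates. -/
theorem bracket_eq (A B C D : Fin 4 → ℝ) :
    bracket A B C D =
      (A 0 * B 1 - A 1 * B 0) * (C 2 * D 3 - C 3 * D 2)
      - (A 0 * B 2 - A 2 * B 0) * (C 1 * D 3 - C 3 * D 1)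
      + (A 0 * B 3 - A 3 * B 0) * (C 1 * D 2 - C 2 * D 1)
      + (A 1 * B 2 - A 2 * B 1) * (C 0 * D 3 - C 3 * D 0)
      - (A 1 * B 3 - A 3 * B 1) * (C 0 * D 2 - C 2 * D 0)
      + (A 2 * B 3 - A 3 * B 2) * (C 0 * D 1 - C 1 * D 0) := by
  simp [bracket, det_succ_row_zero, Fin.sum_univ_succ, Fin.succAbove]
  ring

/-- Laplace expansion of a `5 × 5` determinant along its first row, in terms of brackets. -/
theorem det_row_cons_bracket (a b c d e : ℝ) (A B C D E : Fin 4 → ℝ) :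
    (!![a, b, c, d, e;
        A 0, B 0, C 0, D 0, E 0;
        A 1, B 1, C 1, D 1, E 1;
        A 2, B 2, C 2, D 2, E 2;
        A 3, B 3, C 3, D 3, E 3] : Matrix (Fin 5) (Fin 5) ℝ).det =
      a * bracket B C D E - b * bracket A C D E + c * bracket A B D E
        - d * bracket A B C E + e * bracket A B C D := by
  simp only [bracket_eq]
  simp [det_succ_row_zero, Fin.sum_univ_succ, Fin.succAbove]
  ring

/-- Expansion of a determinant along a column supported in the first two rows. -/
theorem det_of_column_two_entries {n : ℕ} (M : Matrix (Fin (n + 2)) (Fin (n + 2)) ℝ)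
    (k : Fin (n + 2)) (h : ∀ i : Fin n, M i.succ.succ k = 0) :
    M.det = (-1) ^ (k : ℕ) * (M 0 k * (M.submatrix Fin.succ k.succAbove).det
      - M 1 k * (M.submatrix (Fin.succAbove 1) k.succAbove).det) := by
  rw [det_succ_column M k, Fin.sum_univ_succ, Fin.sum_univ_succ,
    Finset.sum_eq_zero fun i _ => by rw [h]; ring, Fin.succ_zero_eq_one]
  simp only [Fin.val_zero, Fin.val_one, Fin.succAbove_zero]
  ring

/-- Expansion of a `6 × 6` determinant whose last column is supported in the first two rows. -/
theorem det_two_rows_bracket (a b c d e f a' b' c' d' e' f' : ℝ) (A B C D E : Fin 4 → ℝ) :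
    (!![a, b, c, d, e, f;
        a', b', c', d', e', f';
        A 0, B 0, C 0, D 0, E 0, 0;
        A 1, B 1, C 1, D 1, E 1, 0;
        A 2, B 2, C 2, D 2, E 2, 0;
        A 3, B 3, C 3, D 3, E 3, 0] : Matrix (Fin 6) (Fin 6) ℝ).det =
      f' * (a * bracket B C D E - b * bracket A C D E + c * bracket A B D E
        - d * bracket A B C E + e * bracket A B C D)
      - f * (a' * bracket B C D E - b' * bracket A C D E + c' * bracket A B D E
        - d' * bracket A B C E + e' * bracket A B C D) := by
  rw [← det_row_cons_bracket, ← det_row_cons_bracket,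
    det_of_column_two_entries _ 5 fun i => by fin_cases i <;> rfl]
  have hpow : (-1 : ℝ) ^ ((5 : Fin 6) : ℕ) = -1 := by norm_num
  rw [hpow, neg_one_mul, neg_sub]
  congr 3 <;> (ext i j; fin_cases i <;> fin_cases j <;> rfl)

/-- The singularity polynomial of a design with planar base. -/
theorem det_Smat_of_planar (r x y z : Fin 5 → ℝ) (hz : ∀ j, z j = 0) (u v w px py pz : ℝ) :
    (Smat r x y z u v w px py pz).det =
      pz * w * bracket (colVec x) (colVec y) (colProd r x) (colProd r y)
      - w * (u * pz - w * px) * bracket (colVec r) (colVec y) (colProd r x) (colProd r y)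
      + w * (v * pz - w * py) * bracket (colVec r) (colVec x) (colProd r x) (colProd r y)
      - pz * (px * w - u * pz) * bracket (colVec r) (colVec x) (colVec y) (colProd r y)
      + pz * (py * w - v * pz) * bracket (colVec r) (colVec x) (colVec y) (colProd r x) := by
  have hw := det_two_rows_bracket 0 px py 0 0 0 0 0 0 u v w
    (colVec r) (colVec x) (colVec y) (colProd r x) (colProd r y)
  have hp := det_two_rows_bracket 1 u v px py pz 0 0 0 u v w
    (colVec r) (colVec x) (colVec y) (colProd r x) (colProd r y)
  have hcol : ∀ i : Fin 5, Smat r x y z u v w px py pz i.succ.succ 3 = 0 := fun i => by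
    fin_cases i
    exacts [rfl, hz 1, hz 2, hz 3, hz 4]
  rw [det_of_column_two_entries _ 3 hcol, Smat]
  simp only [hz, mul_zero]
  have hpow : (-1 : ℝ) ^ ((3 : Fin 7) : ℕ) = -1 := by norm_num
  rw [hpow, neg_one_mul, neg_sub]
  refine (congrArg₂ (· - ·) (congrArg (pz * ·) (Eq.trans (congrArg det ?_) hp))
    (congrArg (w * ·) (Eq.trans (congrArg det ?_) hw))).trans ?_
  · ext i j
    fin_cases i <;> fin_cases j <;> rfl
  · ext i j
    fin_cases i <;> fin_cases j <;> rfl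
  · ring

/-- A vanishing bracket yields a nontrivial linear relation between its columns. -/
theorem exists_relation_of_bracket_eq_zero {A B C D : Fin 4 → ℝ} (h : bracket A B C D = 0) :
    ∃ a b c d : ℝ, (a ≠ 0 ∨ b ≠ 0 ∨ c ≠ 0 ∨ d ≠ 0) ∧
      ∀ i, a * A i + b * B i + c * C i + d * D i = 0 := by
  obtain ⟨t, ht, hM⟩ := exists_mulVec_eq_zero_iff.mpr h
  refine ⟨t 0, t 1, t 2, t 3, ?_, fun i => ?_⟩
  · by_contra! hc
    exact ht (by ext i; fin_cases i <;> simp [hc])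
  · have := congrFun hM i
    simp [mulVec, dotProduct, Fin.sum_univ_four] at this
    linarith

/-- If `x` and `y` are proportional, the design is architecturally singular. -/
theorem archSingular_of_proportional {r x y z : Fin 5 → ℝ} (hz : ∀ j, z j = 0) {b c : ℝ}
    (hbc : b ≠ 0 ∨ c ≠ 0) (h : ∀ i : Fin 4, b * x i.succ + c * y i.succ = 0) :
    ArchSingular r x y z := by
  intro u v w px py pz _
  rw [det_Smat_of_planar r x y z hz]
  simp only [bracket_eq, colVec, colProd]
  rcases hbc with hb | hc
  · have hx : ∀ i : Fin 4, x i.succ = -c / b * y i.succ := fun i => by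
      field_simp; linarith [h i]
    simp only [hx]
    ring
  · have hy : ∀ i : Fin 4, y i.succ = -b / c * x i.succ := fun i => by
      field_simp; linarith [h i]
    simp only [hy]
    ring

/-- If `rx` and `ry` lie in the span of `r`, `x`, `y`, the design is architecturally singular. -/
theorem archSingular_of_mem_span {r x y z : Fin 5 → ℝ} (hz : ∀ j, z j = 0)
    {a b c a' b' c' : ℝ}
    (h : ∀ i : Fin 4, r i.succ * x i.succ = a * r i.succ + b * x i.succ + c * y i.succ)
    (h' : ∀ i : Fin 4, r i.succ * y i.succ = a' * r i.succ + b' * x i.succ + c' * y i.succ) :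
    ArchSingular r x y z := by
  intro u v w px py pz _
  rw [det_Smat_of_planar r x y z hz]
  simp only [bracket_eq, colVec, colProd, h, h']
  ring

/-- A nontrivial relation between `r`, `x`, `y` expresses `r` through `x` and `y`, unless the
design is architecturally singular. -/
theorem exists_coeff_of_relation {r x y z : Fin 5 → ℝ} (hz : ∀ j, z j = 0)
    (hr1 : r 0 = 0) (hx1 : x 0 = 0) (hy1 : y 0 = 0) (hns : ¬ ArchSingular r x y z)
    {a b c : ℝ} (habc : a ≠ 0 ∨ b ≠ 0 ∨ c ≠ 0)
    (h : ∀ i : Fin 4, a * r i.succ + b * x i.succ + c * y i.succ = 0) :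
    ∃ α β : ℝ, ∀ j : Fin 5, r j = α * x j + β * y j := by
  by_cases ha : a = 0
  · exact absurd (archSingular_of_proportional hz (habc.resolve_left (not_not.mpr ha))
      fun i => by simpa [ha] using h i) hns
  · refine ⟨-b / a, -c / a, fun j => ?_⟩
    cases j using Fin.cases with
    | zero => simp [hr1, hx1, hy1]
    | succ i => field_simp; linarith [h i]

theorem stmt3 (r x y z : Fin 5 → ℝ)
    (hr1 : r 0 = 0) (hx1 : x 0 = 0) (hy1 : y 0 = 0) (hz1 : z 0 = 0)
    (hplanar : ∀ j, z j = 0)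
    (hns : ¬ ArchSingular r x y z) :
    (∀ u v w : ℝ, ∃ a b c d : ℝ, ∀ px py pz : ℝ,
        (Smat r x y z u v w px py pz).det = a * px + b * py + c * pz + d) ↔
      ∃ α β : ℝ, ∀ j : Fin 5, r j = α * x j + β * y j := by
  constructor
  · intro h
    obtain ⟨a, b, c, d, h⟩ := h 0 0 1
    simp only [det_Smat_of_planar r x y z hplanar] at h
    have h0 := h 0 0 0
    have hpx := h 1 0 0
    have hpy := h 0 1 0
    have hpz := h 0 0 1
    have hrxy : bracket (colVec r) (colVec x) (colVec y) (colProd r y) = 0 := by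
      linarith [h 1 0 1]
    have hrxx : bracket (colVec r) (colVec x) (colVec y) (colProd r x) = 0 := by
      linarith [h 0 1 1]
    obtain ⟨a₁, b₁, c₁, d₁, hne₁, h₁⟩ := exists_relation_of_bracket_eq_zero hrxx
    obtain ⟨a₂, b₂, c₂, d₂, hne₂, h₂⟩ := exists_relation_of_bracket_eq_zero hrxy
    simp only [colVec, colProd] at h₁ h₂
    by_cases hd₁ : d₁ = 0
    · exact exists_coeff_of_relation hplanar hr1 hx1 hy1 hns (a := a₁) (b := b₁) (c := c₁)
        (by simpa [hd₁] using hne₁) fun i => by simpa [hd₁] using h₁ i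
    by_cases hd₂ : d₂ = 0
    · exact exists_coeff_of_relation hplanar hr1 hx1 hy1 hns (a := a₂) (b := b₂) (c := c₂)
        (by simpa [hd₂] using hne₂) fun i => by simpa [hd₂] using h₂ i
    refine absurd (archSingular_of_mem_span hplanar
      (a := -a₁ / d₁) (b := -b₁ / d₁) (c := -c₁ / d₁)
      (a' := -a₂ / d₂) (b' := -b₂ / d₂) (c' := -c₂ / d₂) (fun i => ?_) fun i => ?_) hns
    · field_simp; linarith [h₁ i]
    · field_simp; linarith [h₂ i]
  · rintro ⟨α, β, h⟩ u v w
    have hzero : ∀ D, bracket (colVec r) (colVec x) (colVec y) D = 0 := fun D => by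
      simp only [bracket_eq, colVec, h]
      ring
    refine ⟨w * w * bracket (colVec r) (colVec y) (colProd r x) (colProd r y),
      -(w * w) * bracket (colVec r) (colVec x) (colProd r x) (colProd r y),
      w * bracket (colVec x) (colVec y) (colProd r x) (colProd r y)
        - w * u * bracket (colVec r) (colVec y) (colProd r x) (colProd r y)
        + w * v * bracket (colVec r) (colVec x) (colProd r x) (colProd r y),
      0, fun px py pz => ?_⟩
    rw [det_Smat_of_planar r x y z hplanar, hzero, hzero]
    ring
end

section
/- Let a linear pentapod design have a planar base and suppose [r,X,Y,rY] = [r,X,Y,rX] = 0. If the vectors r, X, Y ∈ ℝ⁴ are linearly independent, then the architecture matrix A has rank strictly less than 4 (so the design is architecturally singular). -/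
open Matrix

/-- If `a, b, c` are linearly independent and `[a, b, c, d] = 0`, then every vector orthogonal to
`a`, `b` and `c` is orthogonal to `d`. -/
theorem dotProduct_eq_zero_of_bracket_eq_zero {a b c d w : Fin 4 → ℝ}
    (hli : LinearIndependent ℝ ![a, b, c]) (h : bracket a b c d = 0)
    (ha : w ⬝ᵥ a = 0) (hb : w ⬝ᵥ b = 0) (hc : w ⬝ᵥ c = 0) : w ⬝ᵥ d = 0 := by
  obtain ⟨v, hv, hMv⟩ := Matrix.exists_mulVec_eq_zero_iff.mpr h
  have hsum : v 0 • a + v 1 • b + v 2 • c + v 3 • d = 0 := by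
    funext i
    have := congrFun hMv i
    simp [Matrix.mulVec, dotProduct, Fin.sum_univ_four] at this ⊢
    linarith
  have hv3 : v 3 ≠ 0 := by
    intro h3
    have hz := Fintype.linearIndependent_iff.mp hli ![v 0, v 1, v 2] (by
      simpa [Fin.sum_univ_three, h3] using hsum)
    refine hv (funext fun i => ?_)
    fin_cases i
    · exact hz 0
    · exact hz 1
    · exact hz 2
    · exact h3
  have hw := congrArg (w ⬝ᵥ ·) hsum
  simpa [dotProduct_add, ha, hb, hc, hv3] using hw

/-- A matrix whose rows satisfy a nontrivial linear relation does not have full row rank. -/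
theorem rank_lt_of_vecMul_eq_zero {m n : Type*} [Fintype m] [Fintype n] {A : Matrix m n ℝ}
    {w : m → ℝ} (hw : w ≠ 0) (h : w ᵥ* A = 0) : A.rank < Fintype.card m := by
  have hker : Aᵀ.mulVecLin.ker ≠ ⊥ := fun hbot => hw <| by
    rw [LinearMap.ker_eq_bot'] at hbot
    exact hbot w (by simpa [Matrix.mulVec_transpose] using h)
  have hpos : 0 < Module.finrank ℝ Aᵀ.mulVecLin.ker :=
    Nat.pos_of_ne_zero fun h0 => hker (Submodule.finrank_eq_zero.mp h0)
  have hrn := Aᵀ.mulVecLin.finrank_range_add_finrank_ker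
  rw [Module.finrank_fintype_fun_eq_card] at hrn
  rw [← Matrix.rank_transpose, Matrix.rank]
  omega

theorem stmt10 (r x y z : Fin 5 → ℝ)
    (hr1 : r 0 = 0) (hx1 : x 0 = 0) (hy1 : y 0 = 0) (hz1 : z 0 = 0)
    (hplanar : ∀ j, z j = 0)
    (hb1 : bracket (colVec r) (colVec x) (colVec y) (colProd r y) = 0)
    (hb2 : bracket (colVec r) (colVec x) (colVec y) (colProd r x) = 0)
    (hli : LinearIndependent ℝ ![colVec r, colVec x, colVec y]) :
    (archMat r x y z).rank < 4 ∧ ArchSingular r x y z := by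
  obtain ⟨w, hw, hwM⟩ := Matrix.exists_vecMul_eq_zero_iff.mpr hb1
  have hr : w ⬝ᵥ colVec r = 0 := congrFun hwM 0
  have hx : w ⬝ᵥ colVec x = 0 := congrFun hwM 1
  have hy : w ⬝ᵥ colVec y = 0 := congrFun hwM 2
  have hry : w ⬝ᵥ colProd r y = 0 := congrFun hwM 3
  have hrx := dotProduct_eq_zero_of_bracket_eq_zero hli hb2 hr hx hy
  simp only [dotProduct, colVec, colProd, Fin.sum_univ_four, Fin.isValue, Fin.succ_zero_eq_one,
    Fin.succ_one_eq_two, Fin.reduceSucc] at hr hx hy hry hrx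
  constructor
  · refine rank_lt_of_vecMul_eq_zero (m := Fin 4) hw (funext fun j => ?_)
    fin_cases j <;>
      simp [archMat, Matrix.vecMul, dotProduct, Fin.sum_univ_four, hplanar] <;> assumption
  · intro u v t px py pz _
    refine Matrix.exists_vecMul_eq_zero_iff.mp
      ⟨![0, 0, 0, w 0, w 1, w 2, w 3], fun h0 => hw (funext fun i => ?_), funext fun j => ?_⟩
    · fin_cases i
      · exact congrFun h0 3
      · exact congrFun h0 4
      · exact congrFun h0 5
      · exact congrFun h0 6
    · fin_cases j <;>
        simp [Smat, Matrix.vecMul, dotProduct, Fin.sum_univ_seven, hplanar] <;> assumption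
end

section
/- Let a linear pentapod design have a planar base and suppose there exist α, β ∈ ℝ with r_j = α r_j x_j + β r_j y_j for all j = 1,…,5 (the design family with singularity polynomial linear in the orientation variables). Then for every fixed orientation (u,v,w) ∈ ℝ³ there exist real numbers B_1, B_2, B_3, B_4 (depending on the design and the orientation) such that det S(u,v,w,p_x,p_y,p_z) = p_z·(B_1 p_x + B_2 p_y + B_3 p_z + B_4) for all (p_x,p_y,p_z) ∈ ℝ³. -/
open Matrix

/-- If the lower left block is `D * K`, block column reduction removes it. -/
theorem det_fromBlocks_mul_right {m n R : Type*} [Fintype m] [Fintype n] [DecidableEq m]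
    [DecidableEq n] [CommRing R] (A : Matrix m m R) (B : Matrix m n R) (D : Matrix n n R)
    (K : Matrix n m R) :
    (fromBlocks A B (D * K) D).det = (A - B * K).det * D.det := by
  have h : fromBlocks A B (D * K) D = fromBlocks (A - B * K) B 0 D * fromBlocks 1 0 K 1 := by
    simp [fromBlocks_multiply]
  rw [h, det_mul, det_fromBlocks_zero₂₁, det_fromBlocks_zero₁₂]
  simp

/-- Lists the columns of `Smat` supported on the first three rows (up to a combination of the
others) before the remaining ones. -/
def columnPerm : Equiv.Perm (Fin 7) where
  toFun := ![0, 3, 6, 1, 2, 4, 5]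
  invFun := ![0, 3, 4, 1, 5, 6, 2]
  left_inv := by decide
  right_inv := by decide

theorem sign_columnPerm : Equiv.Perm.sign columnPerm = 1 := by decide

/-- For a planar base with `r = α • rX + β • rY`, the singularity polynomial factors through the
bracket `[X, Y, rX, rY]`. -/
theorem Smat_det_of_planar (r x y z : Fin 5 → ℝ) (u v w px py pz α β : ℝ)
    (hz : ∀ j, z j = 0) (hr : ∀ j, r j = α * (r j * x j) + β * (r j * y j)) :
    (Smat r x y z u v w px py pz).det =
      bracket (colVec x) (colVec y) (colProd r x) (colProd r y) *
        (pz * (w * (1 - α * px - β * py) + pz * (α * u + β * v))) := by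
  set D : Matrix (Fin 4) (Fin 4) ℝ :=
    of fun i j => ![colVec x, colVec y, colProd r x, colProd r y] j i with hD
  set A : Matrix (Fin 3) (Fin 3) ℝ := !![1, w, pz; 0, pz, 0; 0, 0, w] with hA
  set B : Matrix (Fin 3) (Fin 4) ℝ := !![u, v, px, py; px, py, 0, 0; 0, 0, u, v] with hB
  set K : Matrix (Fin 4) (Fin 3) ℝ := !![0, 0, 0; 0, 0, 0; α, 0, 0; β, 0, 0] with hK
  have hDK : D * K = of fun i j => ![r i.succ, 0, 0] j := by
    ext i j
    fin_cases j
    · simpa [hD, hK, mul_apply, Fin.sum_univ_four, colProd, mul_comm] using (hr i.succ).symm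
    · simp [hK, mul_apply, Fin.sum_univ_four]
    · simp [hK, mul_apply, Fin.sum_univ_four]
  have hblocks : (Smat r x y z u v w px py pz).submatrix finSumFinEquiv
      (columnPerm ∘ finSumFinEquiv) = fromBlocks A B (D * K) D := by
    rw [hDK]
    ext i j
    rcases i with i | i <;> rcases j with j | j <;> fin_cases i <;> fin_cases j <;>
      first
        | rfl
        | exact hz _
        | exact (congrArg _ (hz _)).trans (mul_zero _)
  have hdet : (Smat r x y z u v w px py pz).det = (fromBlocks A B (D * K) D).det := by
    have h := det_permute' columnPerm (Smat r x y z u v w px py pz)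
    rw [sign_columnPerm, ← det_submatrix_equiv_self (finSumFinEquiv (m := 3) (n := 4)),
      submatrix_submatrix, Function.id_comp, hblocks] at h
    simpa using h.symm
  rw [hdet, det_fromBlocks_mul_right, mul_comm]
  congr 1
  rw [det_fin_three]
  simp [hA, hB, hK]
  ring

theorem stmt15 (r x y z : Fin 5 → ℝ)
    (hr1 : r 0 = 0) (hx1 : x 0 = 0) (hy1 : y 0 = 0) (hz1 : z 0 = 0)
    (hplanar : ∀ j, z j = 0)
    (hκ : ∃ α β : ℝ, ∀ j : Fin 5, r j = α * (r j * x j) + β * (r j * y j)) :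
    ∀ u v w : ℝ, ∃ B1 B2 B3 B4 : ℝ, ∀ px py pz : ℝ,
      (Smat r x y z u v w px py pz).det =
        pz * (B1 * px + B2 * py + B3 * pz + B4) := by
  obtain ⟨α, β, hr⟩ := hκ
  intro u v w
  set D := bracket (colVec x) (colVec y) (colProd r x) (colProd r y) with hD
  refine ⟨-(D * w * α), -(D * w * β), D * (α * u + β * v), D * w, fun px py pz => ?_⟩
  rw [Smat_det_of_planar r x y z u v w px py pz α β hplanar hr, ← hD]
  ring
end

section
/- For any linear pentapod design (planar base not assumed), the following are equivalent: (i) for every fixed values of the other five pose variables the map p_x ↦ det S is affine, and for every fixed values of the other five pose variables the map p_y ↦ det S is affine (i.e., the coefficients of p_x² and p_y² in det S vanish for all orientations); (ii) [r,Y,Z,rZ] = [r,Y,Z,rY] = [r,X,Z,rZ] = [r,X,Z,rX] = 0. -/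
open Matrix

theorem exists_quadratic_eq_affine_iff (c d e : ℝ) :
    (∃ a b : ℝ, ∀ t : ℝ, c * t ^ 2 + d * t + e = a * t + b) ↔ c = 0 := by
  constructor
  · rintro ⟨a, b, h⟩
    linarith [h 0, h 1, h (-1)]
  · rintro rfl
    exact ⟨d, e, fun t => by ring⟩

/-- A determinant two of whose rows depend affinely on `t` is affine in `t` if and only if the
determinant formed with the directions of these rows vanishes. -/
theorem exists_det_updateRow_eq_affine_iff {n : Type*} [Fintype n] [DecidableEq n]
    (N : Matrix n n ℝ) {i j : n} (hij : i ≠ j) (p q f g : n → ℝ) :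
    (∃ a b : ℝ, ∀ t : ℝ,
        ((N.updateRow i (p + t • f)).updateRow j (q + t • g)).det = a * t + b) ↔
      ((N.updateRow i f).updateRow j g).det = 0 := by
  rw [← exists_quadratic_eq_affine_iff _
    (((N.updateRow i f).updateRow j q).det + ((N.updateRow i p).updateRow j g).det)
    ((N.updateRow i p).updateRow j q).det]
  have key (t : ℝ) : ((N.updateRow i (p + t • f)).updateRow j (q + t • g)).det =
      ((N.updateRow i f).updateRow j g).det * t ^ 2 +
        (((N.updateRow i f).updateRow j q).det + ((N.updateRow i p).updateRow j g).det) * t +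
        ((N.updateRow i p).updateRow j q).det := by
    rw [det_updateRow_add, det_updateRow_smul]
    simp only [updateRow_comm _ hij, det_updateRow_add, det_updateRow_smul]
    ring
  simp only [key]

theorem det_eq_of_row_zero_eq_single {R : Type*} [CommRing R] {n : ℕ}
    {M : Matrix (Fin (n + 1)) (Fin (n + 1)) R} {j : Fin (n + 1)} (h : M 0 = Pi.single j 1) :
    M.det = (-1) ^ (j : ℕ) * (M.submatrix Fin.succ j.succAbove).det := by
  rw [det_succ_row_zero, Finset.sum_eq_single j] <;> simp +contextual [h]

/-- The `5 × 5` matrix with columns `A, B, C, D, E` below the row `(0, 0, 0, a, b)`. -/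
def borderedMat (a b : ℝ) (A B C D E : Fin 4 → ℝ) : Matrix (Fin 5) (Fin 5) ℝ :=
  Matrix.of (vecCons ![0, 0, 0, a, b] fun i => ![A i, B i, C i, D i, E i])

theorem det_borderedMat (a b : ℝ) (A B C D E : Fin 4 → ℝ) :
    (borderedMat a b A B C D E).det = b * bracket A B C D - a * bracket A B C E := by
  have h₃ : (borderedMat a b A B C D E).submatrix Fin.succ (Fin.succAbove 3) =
      Matrix.of fun i j => ![A, B, C, E] j i := by
    ext i j
    fin_cases j <;> rfl
  have h₄ : (borderedMat a b A B C D E).submatrix Fin.succ (Fin.succAbove 4) =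
      Matrix.of fun i j => ![A, B, C, D] j i := by
    ext i j
    fin_cases j <;> rfl
  rw [det_succ_row_zero, Fin.sum_univ_five, h₃, h₄, ← bracket, ← bracket]
  simp only [borderedMat, of_apply, cons_val]
  norm_num
  ring

theorem exists_det_Smat_eq_affine_px_iff (r x y z : Fin 5 → ℝ) (u v w py pz : ℝ) :
    (∃ a b : ℝ, ∀ px : ℝ, (Smat r x y z u v w px py pz).det = a * px + b) ↔
      v * bracket (colVec r) (colVec y) (colVec z) (colProd r z) =
        w * bracket (colVec r) (colVec y) (colVec z) (colProd r y) := by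
  have hS (px : ℝ) : Smat r x y z u v w px py pz =
      ((Smat r x y z u v w 0 0 0).updateRow 0
        (![1, u, v, w, 0, py, pz] + px • Pi.single 4 1)).updateRow 1
        (![0, 0, py, pz, 0, 0, 0] + px • Pi.single 1 1) := by
    ext i j
    fin_cases i <;> fin_cases j <;> simp [Smat, updateRow_apply, -cons_add, -add_cons]
  have hsub : ((((Smat r x y z u v w 0 0 0).updateRow 0 (Pi.single 4 1)).updateRow 1
      (Pi.single 1 1)).submatrix Fin.succ (Fin.succAbove 4)).submatrix Fin.succ
        (Fin.succAbove 1) =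
      borderedMat v w (colVec r) (colVec y) (colVec z) (colProd r y) (colProd r z) := by
    ext i j
    fin_cases i <;> fin_cases j <;> rfl
  simp only [hS]
  rw [exists_det_updateRow_eq_affine_iff _ (by decide),
    det_eq_of_row_zero_eq_single (j := 4) (by ext j; simp [updateRow_apply]),
    det_eq_of_row_zero_eq_single (j := 1) (by ext j; fin_cases j <;> rfl),
    hsub, det_borderedMat]
  constructor <;> intro h <;> norm_num at h ⊢ <;> linarith

theorem exists_det_Smat_eq_affine_py_iff (r x y z : Fin 5 → ℝ) (u v w px pz : ℝ) :
    (∃ a b : ℝ, ∀ py : ℝ, (Smat r x y z u v w px py pz).det = a * py + b) ↔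
      u * bracket (colVec r) (colVec x) (colVec z) (colProd r z) =
        w * bracket (colVec r) (colVec x) (colVec z) (colProd r x) := by
  have hS (py : ℝ) : Smat r x y z u v w px py pz =
      ((Smat r x y z u v w 0 0 0).updateRow 0
        (![1, u, v, w, px, 0, pz] + py • Pi.single 5 1)).updateRow 1
        (![0, px, 0, pz, 0, 0, 0] + py • Pi.single 2 1) := by
    ext i j
    fin_cases i <;> fin_cases j <;> simp [Smat, updateRow_apply, -cons_add, -add_cons]
  have hsub : ((((Smat r x y z u v w 0 0 0).updateRow 0 (Pi.single 5 1)).updateRow 1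
      (Pi.single 2 1)).submatrix Fin.succ (Fin.succAbove 5)).submatrix Fin.succ
        (Fin.succAbove 2) =
      borderedMat u w (colVec r) (colVec x) (colVec z) (colProd r x) (colProd r z) := by
    ext i j
    fin_cases i <;> fin_cases j <;> rfl
  simp only [hS]
  rw [exists_det_updateRow_eq_affine_iff _ (by decide),
    det_eq_of_row_zero_eq_single (j := 5) (by ext j; simp [updateRow_apply]),
    det_eq_of_row_zero_eq_single (j := 2) (by ext j; fin_cases j <;> rfl),
    hsub, det_borderedMat]
  constructor <;> intro h <;> norm_num at h ⊢ <;> linarith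

theorem stmt17 (r x y z : Fin 5 → ℝ)
    (hr1 : r 0 = 0) (hx1 : x 0 = 0) (hy1 : y 0 = 0) (hz1 : z 0 = 0) :
    ((∀ u v w py pz : ℝ, ∃ a b : ℝ, ∀ px : ℝ,
          (Smat r x y z u v w px py pz).det = a * px + b) ∧
        (∀ u v w px pz : ℝ, ∃ a b : ℝ, ∀ py : ℝ,
          (Smat r x y z u v w px py pz).det = a * py + b)) ↔
      (bracket (colVec r) (colVec y) (colVec z) (colProd r z) = 0 ∧
        bracket (colVec r) (colVec y) (colVec z) (colProd r y) = 0 ∧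
        bracket (colVec r) (colVec x) (colVec z) (colProd r z) = 0 ∧
        bracket (colVec r) (colVec x) (colVec z) (colProd r x) = 0) := by
  simp only [exists_det_Smat_eq_affine_px_iff, exists_det_Smat_eq_affine_py_iff]
  constructor
  · rintro ⟨hx, hy⟩
    exact ⟨by simpa using hx 0 1 0 0 0, by simpa using (hx 0 0 1 0 0).symm,
      by simpa using hy 1 0 0 0 0, by simpa using (hy 0 0 1 0 0).symm⟩
  · rintro ⟨h₁, h₂, h₃, h₄⟩
    simp [h₁, h₂, h₃, h₄]
end
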